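/- arXiv:2507.06681 — 2 statements merged into one kernel-verified Lean document; each statement's English description precedes it below -/
import Mathlib

section
/- Let π denote the prime-counting function. For every integer n ≥ 2 one has Σ_{e≥2} (e−2) · π(n^{1/e}) < π(n), where π(n^{1/e}) means the number of primes p with p^e ≤ n, and the sum is finite since π(n^{1/e}) = 0 once n^{1/e} < 2. -/
open Finset

/-- `piRoot n e` is `π(n^{1/e})`: the number of primes `p` with `p ^ e ≤ n`
(for `e ≥ 1` this is the prime-counting function evaluated at the real `e`-th
root of `n`).  Any such prime satisfies `p ≤ n`, so we may count inside `range (n+1)`. -/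
def piRoot (n e : ℕ) : ℕ :=
  ((Finset.range (n + 1)).filter fun p => Nat.Prime p ∧ p ^ e ≤ n).card

/-- The number of `m ≥ 2` equal to `2` or odd with `m ^ e < 2 ^ (k + 1)`, counted among
`m < 2 ^ ⌈(k + 1) / 3⌉` (no restriction when `e ≥ 3`). -/
def oddRootCount (k e : ℕ) : ℕ :=
  ((range (2 ^ ((k + 3) / 3))).filter fun m =>
    2 ≤ m ∧ (m = 2 ∨ m % 2 = 1) ∧ m ^ e < 2 ^ (k + 1)).card

/-- A decidable upper bound for `∑ (e - 2) * piRoot n e` when `n < 2 ^ (k + 1)`. -/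
def dyadicBound (k : ℕ) : ℕ :=
  ∑ e ∈ Icc 3 k, (e - 2) * oddRootCount k e

lemma piRoot_le_oddRootCount {n k e : ℕ} (hn : n < 2 ^ (k + 1)) (he : 3 ≤ e) :
    piRoot n e ≤ oddRootCount k e := by
  refine card_le_card fun p hp => ?_
  simp only [mem_filter, mem_range] at hp ⊢
  obtain ⟨-, hp, hpe⟩ := hp
  refine ⟨?_, hp.two_le, hp.eq_two_or_odd, hpe.trans_lt hn⟩
  by_contra! h
  have h3 : (2 ^ ((k + 3) / 3)) ^ 3 ≤ p ^ e :=
    (Nat.pow_le_pow_left h 3).trans (Nat.pow_le_pow_right hp.pos he)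
  rw [← pow_mul] at h3
  have : 2 ^ (k + 1) ≤ 2 ^ ((k + 3) / 3 * 3) := Nat.pow_le_pow_right two_pos (by omega)
  omega

lemma piRoot_eq_zero {n k e : ℕ} (hn : n < 2 ^ (k + 1)) (he : k < e) : piRoot n e = 0 := by
  refine card_eq_zero.2 (filter_eq_empty_iff.2 ?_)
  rintro p - ⟨hp, hpe⟩
  have h1 : 2 ^ e ≤ p ^ e := Nat.pow_le_pow_left hp.two_le e
  have h2 : 2 ^ (k + 1) ≤ 2 ^ e := Nat.pow_le_pow_right two_pos he
  omega

lemma sum_sub_two_mul_piRoot_le_dyadicBound {n k : ℕ} (hn : n < 2 ^ (k + 1)) :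
    ∑ e ∈ Icc 2 n, (e - 2) * piRoot n e ≤ dyadicBound k := by
  rw [← sum_filter_ne_zero, dyadicBound]
  refine (sum_le_sum fun e he => ?_).trans
    (sum_le_sum_of_subset (f := fun e => (e - 2) * oddRootCount k e) fun e he => ?_)
  all_goals
    simp only [mem_filter, mem_Icc, mul_ne_zero_iff] at he
    have h3 : 3 ≤ e := by omega
  · exact Nat.mul_le_mul_left _ (piRoot_le_oddRootCount hn h3)
  · refine mem_Icc.2 ⟨h3, ?_⟩
    by_contra! h
    exact he.2.2 (piRoot_eq_zero hn h)

lemma piRoot_one (n : ℕ) : piRoot n 1 = n.primesLE.card := by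
  refine congrArg card ?_
  ext p
  simp only [mem_filter, mem_range, Nat.mem_primesLE, pow_one]
  grind

lemma piRoot_one_mono {m n : ℕ} (h : m ≤ n) : piRoot m 1 ≤ piRoot n 1 := by
  refine card_le_card fun p hp => ?_
  simp only [mem_filter, mem_range, pow_one] at hp ⊢
  grind

lemma two_pow_le_mul_piRoot_add_one {k : ℕ} (hk : 1 ≤ k) :
    2 ^ k ≤ k * (piRoot (2 ^ k) 1 + 1) := by
  have h1 := Chebyshev.two_pow_le_mul_lcmUpto (2 ^ k)
  have h2 : Nat.lcmUpto (2 ^ k) ≤ (2 ^ k) ^ piRoot (2 ^ k) 1 := by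
    rw [Nat.lcmUpto_eq_prod_pow_log, piRoot_one]
    exact prod_le_pow_card _ _ _ fun p _ => Nat.pow_log_le_self p (by positivity)
  have h3 : 2 ^ k + 1 < 2 ^ (k + 1) := by
    have : 2 ^ 1 ≤ 2 ^ k := Nat.pow_le_pow_right two_pos hk
    rw [pow_succ]; omega
  have h4 : 2 ^ 2 ^ k < 2 ^ (k + 1 + k * piRoot (2 ^ k) 1) := by
    rw [pow_add _ (k + 1), pow_mul]
    exact h1.trans_lt ((Nat.mul_le_mul_left _ h2).trans_lt
      (Nat.mul_lt_mul_of_pos_right h3 (by positivity)))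
  have := (Nat.pow_lt_pow_iff_right one_lt_two).1 h4
  linarith

lemma two_mul_sum_sub_two_le_sq (k : ℕ) : 2 * ∑ e ∈ Icc 3 k, (e - 2) ≤ k ^ 2 := by
  induction k with
  | zero => simp
  | succ k ih =>
    rcases lt_or_ge (k + 1) 3 with h | h
    · simp [Icc_eq_empty_of_lt h]
    · rw [sum_Icc_succ_top h, mul_add]
      have : k + 1 - 2 ≤ k := by omega
      nlinarith

lemma two_mul_dyadicBound_le (k : ℕ) : 2 * dyadicBound k ≤ k ^ 2 * 2 ^ ((k + 3) / 3) := by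
  have h : dyadicBound k ≤ (∑ e ∈ Icc 3 k, (e - 2)) * 2 ^ ((k + 3) / 3) := by
    rw [dyadicBound, sum_mul]
    refine sum_le_sum fun e _ => Nat.mul_le_mul_left _ ?_
    exact (card_filter_le _ _).trans_eq (card_range _)
  nlinarith [Nat.mul_le_mul_right (2 ^ ((k + 3) / 3)) (two_mul_sum_sub_two_le_sq k)]

lemma cube_mul_two_pow_lt {k : ℕ} (hk : 19 ≤ k) :
    k ^ 3 * 2 ^ ((k + 3) / 3) + 2 * k < 2 * 2 ^ k := by
  induction k using Nat.strong_induction_on with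
  | _ k ih =>
    rcases lt_or_ge k 22 with h | h
    · interval_cases k <;> norm_num
    · obtain ⟨m, rfl⟩ : ∃ m, k = m + 3 := ⟨k - 3, by omega⟩
      have hm := ih m (by omega) (by omega)
      have hdiv : (m + 3 + 3) / 3 = (m + 3) / 3 + 1 := by omega
      have hcube : (m + 3) ^ 3 ≤ 4 * m ^ 3 := by
        obtain ⟨j, rfl⟩ : ∃ j, m = j + 19 := ⟨m - 19, by omega⟩
        ring_nf
        nlinarith [Nat.zero_le (j ^ 3), Nat.zero_le (j ^ 2)]
      rw [hdiv, pow_succ 2, pow_add 2 m 3]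
      nlinarith [Nat.mul_le_mul_right (2 ^ ((m + 3) / 3)) hcube]

lemma dyadicBound_lt_of_le_seven {k : ℕ} (hk : 1 ≤ k) (hk' : k ≤ 7) :
    dyadicBound k < piRoot (2 ^ k) 1 := by
  interval_cases k <;> decide +kernel

lemma mul_dyadicBound_add_one_lt {k : ℕ} (hk : 8 ≤ k) :
    k * (dyadicBound k + 1) < 2 ^ k := by
  rcases lt_or_ge k 19 with h | h
  · interval_cases k <;> decide +kernel
  · have h1 := Nat.mul_le_mul_left k (two_mul_dyadicBound_le k)
    have h2 := cube_mul_two_pow_lt h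
    nlinarith

lemma dyadicBound_lt_piRoot {k : ℕ} (hk : 1 ≤ k) : dyadicBound k < piRoot (2 ^ k) 1 := by
  rcases lt_or_ge k 8 with h | h
  · exact dyadicBound_lt_of_le_seven hk (by omega)
  · have := (mul_dyadicBound_add_one_lt h).trans_le (two_pow_le_mul_piRoot_add_one hk)
    exact Nat.lt_of_add_lt_add_right (Nat.lt_of_mul_lt_mul_left this)

/-- For every `n ≥ 2`, `Σ_{e ≥ 2} (e−2) · π(n^{1/e}) < π(n)`.  The terms with `e > n`
vanish (since then `2^e > n`), so the sum over `2 ≤ e ≤ n` is the full sum; and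
`π(n) = piRoot n 1`. -/
theorem sum_sub_two_mul_piRoot_lt_pi (n : ℕ) (hn : 2 ≤ n) :
    ∑ e ∈ Finset.Icc 2 n, (e - 2) * piRoot n e < piRoot n 1 :=
  calc ∑ e ∈ Finset.Icc 2 n, (e - 2) * piRoot n e
    _ ≤ dyadicBound (Nat.log 2 n) :=
      sum_sub_two_mul_piRoot_le_dyadicBound (Nat.lt_pow_succ_log_self one_lt_two n)
    _ < piRoot (2 ^ Nat.log 2 n) 1 := dyadicBound_lt_piRoot (Nat.log_pos one_lt_two hn)
    _ ≤ piRoot n 1 := piRoot_one_mono (Nat.pow_log_le_self 2 (by omega))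
end

section
/- Let R be a commutative ℚ-algebra, α_1,…,α_d ∈ R, and let k ≥ 1 and ℓ ≥ 1 be integers. Then Σ_{1≤i_1≤⋯≤i_k≤d} (α_{i_1} α_{i_2} ⋯ α_{i_k})^ℓ = Σ_{(m_1,…,m_k) ∈ Π_k} ∏_{i=1}^k N_{iℓ}^{m_i} / (i^{m_i} · m_i!), where N_j = α_1^j + ⋯ + α_d^j is the j-th power sum and Π_k is the set of partitions of k. In other words, the ℓ-th power sum of the roots of the k-th symmetric power polynomial Sym^k P, where P(T) = ∏_i (1 − α_i T), is given by the partition formula in the power sums N_{iℓ} of P. -/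
open Finset

/-- The `k`-th power sum `N_k = α_1^k + ⋯ + α_d^k`. -/
def powerSum {R : Type*} [CommSemiring R] {d : ℕ} (α : Fin d → R) (k : ℕ) : R :=
  ∑ i, α i ^ k

/-- `Π_k`: the (finite) set of tuples `(m_1, …, m_k)` of nonnegative integers with
`Σ_{i=1}^k i·m_i = k`, encoded as functions `m : Fin k → ℕ` where index `i : Fin k`
stands for the part `i + 1`.  (Any solution automatically satisfies `m_i ≤ k`, so
restricting each coordinate to `range (k+1)` loses nothing.) -/
def partitionTuples (k : ℕ) : Finset (Fin k → ℕ) :=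
  (Fintype.piFinset fun _ => Finset.range (k + 1)).filter
    (fun m => ∑ i, (i.1 + 1) * m i = k)

/-- The functions `m : ι → ℕ` with all values at most `K` and weighted sum `∑ i, w i * m i = n`. -/
def weightedTuples {ι : Type*} [Fintype ι] [DecidableEq ι] (w : ι → ℕ) (K n : ℕ) :
    Finset (ι → ℕ) :=
  (Fintype.piFinset fun _ => Finset.range (K + 1)).filter (fun m => ∑ i, w i * m i = n)

section WeightedTuples

variable {ι : Type*} [Fintype ι] {w : ι → ℕ} {K n : ℕ}

lemma mul_le_of_weighted_sum_eq {m : ι → ℕ} (h : ∑ i, w i * m i = n) (i : ι) :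
    w i * m i ≤ n :=
  h ▸ Finset.single_le_sum (f := fun i => w i * m i) (fun _ _ => Nat.zero_le _) (mem_univ i)

variable [DecidableEq ι]

lemma mem_weightedTuples (hw : ∀ i, 1 ≤ w i) (hn : n ≤ K) {m : ι → ℕ} :
    m ∈ weightedTuples w K n ↔ ∑ i, w i * m i = n := by
  simp only [weightedTuples, mem_filter, Fintype.mem_piFinset, mem_range, and_iff_right_iff_imp]
  intro h i
  have h1 := mul_le_of_weighted_sum_eq h i
  have h2 := Nat.le_mul_of_pos_left (m i) (hw i)
  omega

lemma weightedTuples_zero (hw : ∀ i, 1 ≤ w i) : weightedTuples w K 0 = {0} := by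
  ext m
  rw [mem_weightedTuples hw (Nat.zero_le K)]
  simp only [sum_eq_zero_iff, mem_univ, true_imp_iff, mul_eq_zero, mem_singleton, funext_iff,
    Pi.zero_apply]
  refine forall_congr' fun i => ?_
  have := hw i
  omega

lemma weighted_sum_add_single (w m : ι → ℕ) (i : ι) (j : ℕ) :
    ∑ a, w a * (m + Pi.single i j : ι → ℕ) a = ∑ a, w a * m a + w i * j := by
  simp [mul_add, sum_add_distrib, Pi.single_apply]

/-- Subtracting `j` from the `i`-th coordinate reindexes the tuples whose `i`-th coordinate is at
least `j`. -/
lemma sum_weightedTuples_filter_le {M : Type*} [AddCommMonoid M] (hw : ∀ i, 1 ≤ w i) (i : ι)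
    (j : ℕ) (hn : n + w i * j ≤ K) (F : (ι → ℕ) → M) :
    ∑ m ∈ weightedTuples w K (n + w i * j) with j ≤ m i, F m =
      ∑ m ∈ weightedTuples w K n, F (m + Pi.single i j) := by
  have hn' : n ≤ K := le_trans (Nat.le_add_right _ _) hn
  have key : ∀ m : ι → ℕ, j ≤ m i → m - Pi.single i j + Pi.single i j = m := by
    intro m hm
    ext a
    obtain rfl | ha := eq_or_ne a i
    · simp [hm]
    · simp [ha]
  refine sum_nbij' (fun m => m - Pi.single i j) (fun m => m + Pi.single i j) ?_ ?_ ?_ ?_ ?_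
  · intro m hm
    rw [mem_filter, mem_weightedTuples hw hn] at hm
    rw [mem_weightedTuples hw hn']
    have := weighted_sum_add_single w (m - Pi.single i j) i j
    rw [key m hm.2, hm.1] at this
    omega
  · intro m hm
    rw [mem_weightedTuples hw hn'] at hm
    rw [mem_filter, mem_weightedTuples hw hn, weighted_sum_add_single, hm]
    simp
  · intro m hm
    exact key m (mem_filter.1 hm).2
  · intro m _
    simp
  · intro m hm
    simp only [key m (mem_filter.1 hm).2]

lemma mul_prod_add_single {R : Type*} [CommSemiring R] (c : ι → ℕ → R) (m : ι → ℕ) (i : ι) (j : ℕ)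
    {r q : R} (h : r * c i (m i + j) = q * c i (m i)) :
    r * ∏ a, c a ((m + Pi.single i j : ι → ℕ) a) = q * ∏ a, c a (m a) := by
  rw [← mul_prod_erase _ _ (mem_univ i), ← mul_prod_erase univ (fun a => c a (m a)) (mem_univ i),
    ← mul_assoc, ← mul_assoc]
  congr 1
  · simpa using h
  · refine prod_congr rfl fun a ha => ?_
    simp [ne_of_mem_erase ha]

end WeightedTuples

section CompleteHomogeneous

variable {R : Type*} [CommSemiring R] {d : ℕ}

/-- Newton's identity `n h_n = ∑_{j=1}^n p_j h_{n-j}`, with `h_n` written as a sum over exponent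
vectors. -/
lemma natCast_mul_sum_monomials (α : Fin d → R) {K n : ℕ} (hn : n ≤ K) :
    (n : R) * ∑ m ∈ weightedTuples (fun _ : Fin d => 1) K n, ∏ a, α a ^ m a =
      ∑ j ∈ range n, powerSum α (j + 1) *
        ∑ m ∈ weightedTuples (fun _ : Fin d => 1) K (n - 1 - j), ∏ a, α a ^ m a := by
  have hw : ∀ i : Fin d, 1 ≤ (fun _ : Fin d => 1) i := fun _ => le_rfl
  have step : ∀ m ∈ weightedTuples (fun _ : Fin d => 1) K n, (n : R) * ∏ a, α a ^ m a =
      ∑ j ∈ range n, ∑ i, if j + 1 ≤ m i then ∏ a, α a ^ m a else 0 := by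
    intro m hm
    rw [mem_weightedTuples hw hn] at hm
    rw [sum_comm, ← hm, Nat.cast_sum, sum_mul]
    refine sum_congr rfl fun i _ => ?_
    have hi := mul_le_of_weighted_sum_eq hm i
    rw [hm, ← sum_filter, sum_const, nsmul_eq_mul]
    have : (range n).filter (fun j => j + 1 ≤ m i) = range (m i) := by
      ext j
      simp only [mem_filter, mem_range]
      omega
    rw [this, card_range, one_mul]
  rw [mul_sum, sum_congr rfl step, sum_comm]
  refine sum_congr rfl fun j hj => ?_
  rw [sum_comm, powerSum, sum_mul]
  refine sum_congr rfl fun i _ => ?_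
  have hnj : n = n - 1 - j + 1 * (j + 1) := by
    have := mem_range.1 hj
    omega
  rw [← sum_filter]
  conv_lhs => rw [hnj]
  rw [sum_weightedTuples_filter_le hw i (j + 1) (hnj.symm.trans_le hn), mul_sum]
  refine sum_congr rfl fun m _ => ?_
  have h := mul_prod_add_single (fun a x => α a ^ x) m i (j + 1) (r := 1) (q := α i ^ (j + 1))
    (by ring)
  rwa [one_mul] at h

/-- Monotone functions `Fin k → Fin d` correspond to exponent vectors of degree `k`. -/
lemma sum_monotone_prod_eq_sum_monomials (α : Fin d → R) (k : ℕ) :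
    ∑ f ∈ univ.filter (fun f : Fin k → Fin d => Monotone f), ∏ j, α (f j) =
      ∑ m ∈ weightedTuples (fun _ : Fin d => 1) k k, ∏ a, α a ^ m a := by
  have hw : ∀ i : Fin d, 1 ≤ (fun _ : Fin d => 1) i := fun _ => le_rfl
  refine sum_nbij (fun f a => (List.ofFn f : Multiset (Fin d)).count a) ?_ ?_ ?_ ?_
  · intro f _
    rw [mem_weightedTuples hw le_rfl]
    simp only [one_mul]
    rw [Multiset.sum_count_eq_card (fun a _ => mem_univ a)]
    simp
  · intro f hf g hg hfg
    simp only [coe_filter, mem_univ, true_and, Set.mem_ofPred_eq] at hf hg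
    have h : (List.ofFn f : Multiset (Fin d)) = List.ofFn g :=
      Multiset.ext.2 fun a => congrFun hfg a
    exact List.ofFn_injective
      ((Multiset.coe_eq_coe.1 h).eq_of_sortedLE hf.sortedLE_ofFn hg.sortedLE_ofFn)
  · intro m hm
    rw [mem_coe, mem_weightedTuples hw le_rfl] at hm
    simp only [one_mul] at hm
    set s : Multiset (Fin d) := ∑ a, m a • {a} with hs
    have hcount : ∀ a, s.count a = m a := by
      intro a
      simp [hs, Multiset.count_sum', Multiset.count_singleton]
    have hlen : (s.sort (· ≤ ·)).length = k := by
      simp [hs, hm]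
    obtain ⟨f, hf⟩ : ∃ f : Fin k → Fin d, List.ofFn f = s.sort (· ≤ ·) := by
      subst hlen
      exact ⟨_, List.ofFn_get _⟩
    refine ⟨f, ?_, ?_⟩
    · simp only [coe_filter, mem_univ, true_and, Set.mem_ofPred_eq]
      rw [← List.sortedLE_ofFn_iff, hf]
      exact (s.pairwise_sort _).sortedLE
    · ext a
      simp only [hf, Multiset.sort_eq, hcount]
  · intro f _
    have h := prod_list_map_count (List.ofFn f) α
    rw [List.map_ofFn, List.prod_ofFn] at h
    simp only [Multiset.coe_count]
    refine h.trans (prod_subset (subset_univ _) fun a _ ha => ?_)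
    rw [List.count_eq_zero.2 (by simpa using ha), pow_zero]

end CompleteHomogeneous

section PartitionSum

variable {R : Type*} [CommRing R] [Algebra ℚ R]

/-- Newton-type recursion for the partition sum
`z_n = ∑_m ∏_i p_i ^ m_i / (i ^ m_i * m_i!)`, namely `n z_n = ∑_{j=1}^n p_j z_{n-j}`. -/
lemma natCast_mul_sum_partitions (p : ℕ → R) {K n : ℕ} (hn : n ≤ K) :
    (n : R) * ∑ m ∈ weightedTuples (fun i : Fin K => i.1 + 1) K n, ∏ i : Fin K,
        (((i.1 + 1 : ℚ) ^ m i * ((m i).factorial : ℚ))⁻¹) • p (i.1 + 1) ^ m i =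
      ∑ j ∈ range n, p (j + 1) *
        ∑ m ∈ weightedTuples (fun i : Fin K => i.1 + 1) K (n - 1 - j), ∏ i : Fin K,
          (((i.1 + 1 : ℚ) ^ m i * ((m i).factorial : ℚ))⁻¹) • p (i.1 + 1) ^ m i := by
  have hw : ∀ i : Fin K, 1 ≤ (fun i : Fin K => i.1 + 1) i := fun i => Nat.le_add_left 1 i.1
  set c : Fin K → ℕ → R := fun i x =>
    (((i.1 + 1 : ℚ) ^ x * (x.factorial : ℚ))⁻¹) • p (i.1 + 1) ^ x with hc
  have hcs : ∀ (i : Fin K) (x : ℕ),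
      (((i.1 + 1) * (x + 1) : ℕ) : R) * c i (x + 1) = p (i.1 + 1) * c i x := by
    intro i x
    have h1 : (i.1 + 1 : ℚ) ≠ 0 := by positivity
    have h2 : (x + 1 : ℚ) ≠ 0 := by positivity
    have h3 : (x.factorial : ℚ) ≠ 0 := by positivity
    simp only [hc]
    rw [← nsmul_eq_mul, ← Nat.cast_smul_eq_nsmul ℚ, smul_smul, mul_smul_comm, ← pow_succ']
    congr 1
    push_cast [Nat.factorial_succ]
    field_simp
    ring
  change (n : R) * ∑ m ∈ weightedTuples (fun i : Fin K => i.1 + 1) K n, ∏ i, c i (m i) =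
    ∑ j ∈ range n, p (j + 1) *
      ∑ m ∈ weightedTuples (fun i : Fin K => i.1 + 1) K (n - 1 - j), ∏ i, c i (m i)
  set z : ℕ → R := fun n =>
    ∑ m ∈ weightedTuples (fun i : Fin K => i.1 + 1) K n, ∏ i, c i (m i)
  have hR : ∑ j ∈ range n, p (j + 1) * z (n - 1 - j) =
      ∑ i : Fin K, if i.1 < n then p (i.1 + 1) * z (n - 1 - i.1) else 0 := by
    rw [Fin.sum_univ_eq_sum_range (fun j => if j < n then p (j + 1) * z (n - 1 - j) else 0),
      ← sum_filter]
    congr 1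
    ext j
    simp only [mem_filter, mem_range]
    omega
  refine Eq.trans ?_ hR.symm
  have step : ∀ m ∈ weightedTuples (fun i : Fin K => i.1 + 1) K n, (n : R) * ∏ a, c a (m a) =
      ∑ i : Fin K, if 1 ≤ m i then (((i.1 + 1) * m i : ℕ) : R) * ∏ a, c a (m a) else 0 := by
    intro m hm
    rw [mem_weightedTuples hw hn] at hm
    conv_lhs => rw [← hm]
    rw [Nat.cast_sum, sum_mul]
    refine sum_congr rfl fun i _ => ?_
    split_ifs with h
    · rfl
    · simp [show m i = 0 by omega]
  rw [mul_sum, sum_congr rfl step, sum_comm]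
  refine sum_congr rfl fun i _ => ?_
  split_ifs with hi
  · have hni : n = n - 1 - i.1 + (i.1 + 1) * 1 := by omega
    rw [← sum_filter]
    conv_lhs => rw [hni]
    rw [sum_weightedTuples_filter_le hw i 1 (hni.symm.trans_le hn), mul_sum]
    refine sum_congr rfl fun m _ => ?_
    refine mul_prod_add_single c m i 1 ?_
    simpa using hcs i (m i)
  · refine sum_eq_zero fun m hm => ?_
    rw [mem_weightedTuples hw hn] at hm
    refine if_neg fun h => hi ?_
    have h1 := mul_le_of_weighted_sum_eq hm i
    have h2 := Nat.le_mul_of_pos_right (i.1 + 1) h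
    omega

end PartitionSum

/-- A sequence in a `ℚ`-algebra satisfying `n a_n = ∑_{j=1}^n p_j a_{n-j}` is determined by its
initial value. -/
lemma eq_of_newton_recursion {R : Type*} [CommRing R] [Algebra ℚ R] {K : ℕ} {p a b : ℕ → R}
    (h0 : a 0 = b 0)
    (ha : ∀ n ≤ K, (n : R) * a n = ∑ j ∈ range n, p (j + 1) * a (n - 1 - j))
    (hb : ∀ n ≤ K, (n : R) * b n = ∑ j ∈ range n, p (j + 1) * b (n - 1 - j)) :
    ∀ n ≤ K, a n = b n := by
  intro n
  induction n using Nat.strong_induction_on with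
  | _ n ih =>
    intro hn
    obtain rfl | hpos := Nat.eq_zero_or_pos n
    · exact h0
    have hq : (n : ℚ) ≠ 0 := by positivity
    have hunit : IsUnit (n : R) := by
      simpa using (IsUnit.mk0 (n : ℚ) hq).map (algebraMap ℚ R)
    refine hunit.mul_left_cancel ?_
    rw [ha n hn, hb n hn]
    refine sum_congr rfl fun j hj => ?_
    rw [ih (n - 1 - j) (by omega) (by omega)]

/-- In a commutative `ℚ`-algebra, the `ℓ`-th power sum of the roots of `Sym^k P`,
namely `Σ_{1≤i_1≤⋯≤i_k≤d} (α_{i_1}⋯α_{i_k})^ℓ`, equals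
`Σ_{(m_1,…,m_k) ∈ Π_k} ∏_{i=1}^k N_{iℓ}^{m_i} / (i^{m_i} · m_i!)`. -/
theorem powerSum_symPow_eq_sum_partitions
    {R : Type*} [CommRing R] [Algebra ℚ R] {d : ℕ} (α : Fin d → R)
    (k ℓ : ℕ) (hk : 1 ≤ k) (hℓ : 1 ≤ ℓ) :
    (∑ f ∈ Finset.univ.filter (fun f : Fin k → Fin d => Monotone f),
        (∏ j, α (f j)) ^ ℓ) =
      ∑ m ∈ partitionTuples k, ∏ i : Fin k,
        ((((i.1 + 1 : ℚ)) ^ m i * (Nat.factorial (m i) : ℚ))⁻¹) •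
          (powerSum α ((i.1 + 1) * ℓ)) ^ m i := by
  simp only [← prod_pow]
  rw [sum_monotone_prod_eq_sum_monomials (fun i => α i ^ ℓ) k]
  have hp : ∀ j, powerSum α (j * ℓ) = powerSum (fun i => α i ^ ℓ) j := by
    intro j
    simp only [powerSum, ← pow_mul, mul_comm]
  simp only [hp]
  refine eq_of_newton_recursion (K := k)
    (a := fun n => ∑ m ∈ weightedTuples (fun _ : Fin d => 1) k n, ∏ a, (α a ^ ℓ) ^ m a)
    (b := fun n => ∑ m ∈ weightedTuples (fun i : Fin k => i.1 + 1) k n, ∏ i : Fin k,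
      (((i.1 + 1 : ℚ) ^ m i * ((m i).factorial : ℚ))⁻¹) •
        powerSum (fun i => α i ^ ℓ) (i.1 + 1) ^ m i)
    ?_ (fun n hn => natCast_mul_sum_monomials _ hn)
    (fun n hn => natCast_mul_sum_partitions _ hn) k le_rfl
  rw [weightedTuples_zero (fun _ => le_rfl),
    weightedTuples_zero (fun i : Fin k => Nat.le_add_left 1 i.1)]
  simp
end
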